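/- Let λ be a nontrivial additive character of F_q and let U ∈ M_n(F_q) have rank u < n. Then ∑_{X ∈ GL_n(F_q)} λ(tr(U^t X)) = (-1)^u · q^{n(n-1)/2} · ∏_{i=1}^{n-u} (q^i - 1). -/

import Mathlib

open Matrix Finset

section

variable {F : Type*} [Field F]

theorem Submodule.finrank_map_add_finrank_ker {V W : Type*} [AddCommGroup V] [Module F V]
    [FiniteDimensional F V] [AddCommGroup W] [Module F W] (D : V →ₗ[F] W) {S : Submodule F V}
    (hle : LinearMap.ker D ≤ S) :
    Module.finrank F (S.map D) + Module.finrank F (LinearMap.ker D) = Module.finrank F S := by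
  have h := LinearMap.finrank_range_add_finrank_ker (D.domRestrict S)
  rwa [LinearMap.range_domRestrict, LinearMap.ker_domRestrict,
    LinearEquiv.finrank_eq (Submodule.comapSubtypeEquivOfLe hle)] at h

theorem finrank_span_range_eq_restrict_ker_add_one {V : Type*} [AddCommGroup V] [Module F V]
    [FiniteDimensional F V] {n : ℕ} (f : Fin (n + 1) → Module.Dual F V) (hf : f 0 ≠ 0) :
    Module.finrank F (Submodule.span F (Set.range f)) =
      Module.finrank F (Submodule.span F
        (Set.range fun i : Fin n ↦ (LinearMap.ker (f 0)).dualRestrict (f i.succ))) + 1 := by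
  set D := (LinearMap.ker (f 0)).dualRestrict
  set S := Submodule.span F (Set.range f) with hS
  have hker : LinearMap.ker D = Submodule.span F {f 0} := by
    refine le_antisymm (fun φ hφ ↦ ?_) ?_
    · have h : ∀ x, f 0 x = 0 → φ x = 0 := fun x hx ↦
        LinearMap.congr_fun (LinearMap.mem_ker.1 hφ) ⟨x, hx⟩
      have := mem_span_of_iInf_ker_le_ker (ι := Unit) (L := fun _ ↦ f 0) (K := φ)
        (fun x hx ↦ h x (by simpa using hx))
      simpa using this
    · rw [Submodule.span_singleton_le_iff_mem, LinearMap.mem_ker]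
      ext x
      exact x.2
  have hmap : S.map D = Submodule.span F (Set.range fun i : Fin n ↦ D (f i.succ)) := by
    have h0 : D (f 0) = 0 := LinearMap.mem_ker.1 (hker ▸ Submodule.mem_span_singleton_self _)
    rw [hS, Submodule.map_span, ← Set.range_comp, ← Fin.cons_self_tail (D ∘ f), Fin.range_cons]
    simp [h0, Submodule.span_insert_zero, Fin.tail_def]
  have hle : LinearMap.ker D ≤ S := by
    rw [hker, Submodule.span_singleton_le_iff_mem]
    exact Submodule.subset_span ⟨0, rfl⟩
  rw [← hmap, ← Submodule.finrank_map_add_finrank_ker D hle, hker, finrank_span_singleton hf]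

theorem prod_pow_sub_pow (q n : ℕ) (hq : 1 ≤ q) :
    ((∏ i : Fin n, (q ^ n - q ^ (i : ℕ)) : ℕ) : ℂ) =
      (q : ℂ) ^ (n * (n - 1) / 2) * ∏ i ∈ Icc 1 n, ((q : ℂ) ^ i - 1) := by
  have h : ∀ i ∈ range n, ((q ^ n - q ^ i : ℕ) : ℂ) = (q : ℂ) ^ i * ((q : ℂ) ^ (n - i) - 1) := by
    intro i hi
    have hi' := (mem_range.1 hi).le
    rw [Nat.cast_sub (Nat.pow_le_pow_right hq hi'), mul_sub, ← pow_add, Nat.add_sub_cancel' hi']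
    simp
  rw [Fin.prod_univ_eq_prod_range (fun i ↦ q ^ n - q ^ i) n, Nat.cast_prod, prod_congr rfl h,
    prod_mul_distrib, prod_pow_eq_pow_sum, sum_range_id]
  congr 1
  have hIcc : Icc 1 n = Ico (0 + 1) (n + 1) := by ext; simp
  rw [hIcc, ← Finset.prod_Ico_add' (fun i ↦ (q : ℂ) ^ i - 1) 0 n 1, ← Finset.range_eq_Ico,
    ← Finset.prod_range_reflect]
  refine prod_congr rfl fun i hi ↦ ?_
  have := mem_range.1 hi
  congr 2
  omega

theorem AddChar.sum_comp_linearMap {V : Type*} [AddCommGroup V] [Module F V] [Fintype V]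
    {lam : AddChar F ℂ} (hlam : lam ≠ 1) (g : Module.Dual F V) [Decidable (g = 0)] :
    ∑ x, lam (g x) = if g = 0 then (Fintype.card V : ℂ) else 0 := by
  split_ifs with hg
  · simp [hg]
  · refine AddChar.sum_eq_zero_of_ne_one (ψ := lam.compAddMonoidHom g.toAddMonoidHom) ?_
    obtain ⟨a, ha⟩ := AddChar.ne_one_iff.1 hlam
    obtain ⟨x, rfl⟩ := LinearMap.surjective hg a
    exact AddChar.ne_one_iff.2 ⟨x, ha⟩

variable [Fintype F]

open Classical in
theorem sum_notMem_addChar {V : Type*} [AddCommGroup V] [Module F V] [Fintype V]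
    {lam : AddChar F ℂ} (hlam : lam ≠ 1) {g : Module.Dual F V} (hg : g ≠ 0)
    (W : Submodule F V) :
    ∑ x, (if x ∉ W then lam (g x) else 0) =
      if W ≤ LinearMap.ker g then -(Fintype.card F : ℂ) ^ Module.finrank F W else 0 := by
  have h1 : ∑ x, lam (g x) = 0 := by rw [AddChar.sum_comp_linearMap hlam, if_neg hg]
  have h2 : ∑ x, (if x ∈ W then lam (g x) else 0) =
      if W ≤ LinearMap.ker g then (Fintype.card F : ℂ) ^ Module.finrank F W else 0 := by
    have hle : g.domRestrict W = 0 ↔ W ≤ LinearMap.ker g :=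
      ⟨fun h x hx ↦ LinearMap.congr_fun h ⟨x, hx⟩, fun h ↦ LinearMap.ext fun x ↦ h x.2⟩
    rw [← sum_filter, Finset.sum_subtype (p := (· ∈ W)) _ (by simp)]
    have := AddChar.sum_comp_linearMap hlam (g.domRestrict W)
    simp only [hle, Module.card_eq_pow_finrank (K := F) (V := W), Nat.cast_pow] at this
    exact this
  rw [← sum_filter_add_sum_filter_not univ (· ∈ W), sum_filter, sum_filter] at h1
  rw [eq_neg_of_add_eq_zero_right h1, h2]
  split_ifs <;> simp

open Classical in
theorem sum_linearIndependent_one {V : Type*} [AddCommGroup V] [Module F V] [Fintype V] {n : ℕ}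
    (hV : Module.finrank F V = n) :
    ∑ v : Fin n → V, (if LinearIndependent F v then (1 : ℂ) else 0) =
      (Fintype.card F : ℂ) ^ (n * (n - 1) / 2) *
        ∏ i ∈ Icc 1 n, ((Fintype.card F : ℂ) ^ i - 1) := by
  have h := card_linearIndependent (K := F) (V := V) hV.ge
  rw [hV, Nat.card_eq_fintype_card, Fintype.card_subtype] at h
  rw [Finset.sum_boole, h, prod_pow_sub_pow _ _ Fintype.card_pos]

open Classical in
theorem sum_linearIndependent_addChar_succ {V : Type*} [AddCommGroup V] [Module F V] [Fintype V]
    {lam : AddChar F ℂ} (hlam : lam ≠ 1) {n : ℕ} (f : Fin (n + 1) → Module.Dual F V)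
    (h0 : f 0 ≠ 0) :
    ∑ v : Fin (n + 1) → V, (if LinearIndependent F v then lam (∑ i, f i (v i)) else 0) =
      -(Fintype.card F : ℂ) ^ n * ∑ w : Fin n → LinearMap.ker (f 0),
        (if LinearIndependent F w then
          lam (∑ i, (LinearMap.ker (f 0)).dualRestrict (f i.succ) (w i)) else 0) := by
  have hinner : ∀ w : Fin n → V,
      ∑ x, (if LinearIndependent F (Fin.cons x w : Fin (n + 1) → V) then
        lam (∑ i, f i ((Fin.cons x w : Fin (n + 1) → V) i)) else 0) =
      if LinearIndependent F w ∧ Submodule.span F (Set.range w) ≤ LinearMap.ker (f 0) then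
        -(Fintype.card F : ℂ) ^ n * lam (∑ i, f i.succ (w i)) else 0 := by
    intro w
    by_cases hw : LinearIndependent F w
    · have h := sum_notMem_addChar hlam h0 (Submodule.span F (Set.range w))
      rw [finrank_span_eq_card hw, Fintype.card_fin] at h
      simp only [linearIndependent_finCons, hw, true_and, Fin.sum_univ_succ, Fin.cons_zero,
        Fin.cons_succ, AddChar.map_add_eq_mul, ← ite_zero_mul]
      rw [← Finset.sum_mul, h]
    · simp [linearIndependent_finCons, hw]
  rw [← (Fin.consEquiv fun _ ↦ V).sum_comp, Fintype.sum_prod_type_right]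
  refine (Finset.sum_congr rfl fun w _ ↦ hinner w).trans ?_
  rw [Finset.mul_sum]
  symm
  refine Fintype.sum_of_injective (fun w i ↦ (w i : V)) (fun w w' h ↦ ?_) _ _
    (fun w hw ↦ ?_) fun w ↦ ?_
  · ext i
    exact congr_fun h i
  · refine if_neg fun h ↦ hw ⟨fun i ↦ ⟨w i, h.2 (Submodule.subset_span ⟨i, rfl⟩)⟩, rfl⟩
  · have hLI : LinearIndependent F (fun i ↦ (w i : V)) ↔ LinearIndependent F w :=
      LinearMap.linearIndependent_iff (LinearMap.ker (f 0)).subtype (Submodule.ker_subtype _)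
    have hle : Submodule.span F (Set.range fun i ↦ (w i : V)) ≤ LinearMap.ker (f 0) :=
      Submodule.span_le.2 (Set.range_subset_iff.2 fun i ↦ (w i).2)
    simp [hLI, hle]

open Classical in
theorem sum_linearIndependent_addChar {lam : AddChar F ℂ} (hlam : lam ≠ 1) (n : ℕ) :
    ∀ {V : Type*} [AddCommGroup V] [Module F V] [Fintype V] (_ : Module.finrank F V = n)
      (f : Fin n → Module.Dual F V),
    ∑ v : Fin n → V, (if LinearIndependent F v then lam (∑ i, f i (v i)) else 0) =
      (-1 : ℂ) ^ Module.finrank F (Submodule.span F (Set.range f)) *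
        (Fintype.card F : ℂ) ^ (n * (n - 1) / 2) *
        ∏ i ∈ Icc 1 (n - Module.finrank F (Submodule.span F (Set.range f))),
          ((Fintype.card F : ℂ) ^ i - 1) := by
  induction n with
  | zero =>
    intro V _ _ _ hV f
    have hspan : Module.finrank F (Submodule.span F (Set.range f)) = 0 := by
      rw [Set.range_eq_empty, Submodule.span_empty, finrank_bot]
    rw [hspan]
    simp
  | succ n ih =>
    intro V _ _ _ hV f
    by_cases hf : f = 0
    · subst hf
      have hspan : Module.finrank F
          (Submodule.span F (Set.range (0 : Fin (n + 1) → Module.Dual F V))) = 0 := by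
        rw [Submodule.span_eq_bot.2 (by simp), finrank_bot]
      rw [hspan]
      simpa using sum_linearIndependent_one hV
    wlog h0 : f 0 ≠ 0 generalizing f
    · obtain ⟨j, hj⟩ := Function.ne_iff.1 hf
      have key := this (f ∘ Equiv.swap 0 j) (fun h ↦ hj (by
        simpa using congr_fun h 0)) (by simpa using hj)
      rw [Set.range_comp, Equiv.range_eq_univ, Set.image_univ] at key
      rw [← key]
      refine Fintype.sum_equiv ((Equiv.swap 0 j).arrowCongr (Equiv.refl V)) _ _ fun v ↦ ?_
      have e1 : (Equiv.swap 0 j).arrowCongr (Equiv.refl V) v = v ∘ Equiv.swap 0 j := by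
        ext i; simp
      rw [e1, linearIndependent_equiv]
      congr 2
      exact (Equiv.sum_comp (Equiv.swap 0 j) fun i ↦ f i (v i)).symm
    have hK : Module.finrank F (LinearMap.ker (f 0)) = n := by
      have := Module.Dual.finrank_ker_add_one_of_ne_zero h0
      omega
    have IH := ih hK fun i ↦ (LinearMap.ker (f 0)).dualRestrict (f i.succ)
    rw [finrank_span_range_eq_restrict_ker_add_one f h0]
    generalize Module.finrank F (Submodule.span F
      (Set.range fun i : Fin n ↦ (LinearMap.ker (f 0)).dualRestrict (f i.succ))) = r at IH ⊢
    have hexp : (n + 1) * (n + 1 - 1) / 2 = n * (n - 1) / 2 + n := by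
      rw [← sum_range_id, ← sum_range_id, sum_range_succ]
    rw [hexp, Nat.add_sub_add_right, pow_succ, pow_add]
    rw [sum_linearIndependent_addChar_succ hlam f h0, IH]
    ring

end

theorem gauss_sum_GL_low_rank {n : ℕ} {F : Type} [Field F] [Fintype F] [DecidableEq F]
    (lam : AddChar F ℂ) (hlam : lam ≠ 1)
    (U : Matrix (Fin n) (Fin n) F) (u : ℕ) (hu : U.rank = u) (hun : u < n) :
    ∑ X : GL (Fin n) F,
        lam ((Uᵀ * (X : Matrix (Fin n) (Fin n) F)).trace) =
      (-1 : ℂ) ^ u * (Fintype.card F : ℂ) ^ (n * (n - 1) / 2) *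
        ∏ i ∈ Finset.Icc 1 (n - u), ((Fintype.card F : ℂ) ^ i - 1) := by
  classical
  set f : Fin n → Module.Dual F (Fin n → F) := fun j ↦ dotProductEquiv F (Fin n) (U.col j)
  have hrank : Module.finrank F (Submodule.span F (Set.range f)) = u := by
    rw [← hu, rank_eq_finrank_span_cols, show f = dotProductEquiv F (Fin n) ∘ U.col from rfl,
      Set.range_comp, ← LinearEquiv.coe_toLinearMap, ← Submodule.map_span]
    exact LinearEquiv.finrank_map_eq _ _
  have key := sum_linearIndependent_addChar hlam n (Module.finrank_fin_fun F) f
  rw [hrank] at key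
  rw [← key]
  refine Fintype.sum_of_injective (fun X : GL (Fin n) F ↦ (X : Matrix (Fin n) (Fin n) F).col)
    (fun X Y h ↦ ?_) _ _ (fun v hv ↦ ?_) fun X ↦ ?_
  · exact (equiv_GL_linearindependent n).injective (Subtype.ext h)
  · refine if_neg fun h ↦ hv ?_
    obtain ⟨X, hX⟩ := (equiv_GL_linearindependent n).surjective ⟨v, h⟩
    exact ⟨X, congr_arg Subtype.val hX⟩
  · exact (if_pos (equiv_GL_linearindependent n X).2).symm
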